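/- Let p_n denote the n-th prime, and let M be the additive submonoid of ℚ_{≥0}² generated by the set {(1/(2^n p_{2n}), 0) : n ∈ ℕ} ∪ {(1/(2^n p_{2n+1}), 1/p_{2n+1}) : n ∈ ℕ}. Then M is atomic, and every element of this generating set is an atom of M. -/

import Mathlib

/-- The `n`-th prime (`n ≥ 1`), so `nthPrime 1 = 2`. -/
noncomputable def nthPrime (n : ℕ) : ℕ := Nat.nth Nat.Prime (n - 1)

/-- The defining generating set of the rank-2 monoid `M`:
`{(1/(2ⁿ p_{2n}), 0) : n ≥ 1} ∪ {(1/(2ⁿ p_{2n+1}), 1/p_{2n+1}) : n ≥ 1}`, where `pₖ`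
denotes the `k`-th prime. -/
noncomputable def genSet : Set (ℚ × ℚ) :=
  {x | ∃ n : ℕ, 1 ≤ n ∧
    (x = ((1 : ℚ) / (2 ^ n * (nthPrime (2 * n) : ℚ)), 0) ∨
      x = ((1 : ℚ) / (2 ^ n * (nthPrime (2 * n + 1) : ℚ)), 1 / (nthPrime (2 * n + 1) : ℚ)))}

/-- `c` divides `b` in the submonoid `M` of `ℚ≥0 × ℚ≥0`. -/
def DvdIn (M : AddSubmonoid (ℚ × ℚ)) (c b : ℚ × ℚ) : Prop := ∃ e ∈ M, b = c + e

/-- `u` is an invertible element (unit) of the monoid `M`. -/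
def IsUnitIn (M : AddSubmonoid (ℚ × ℚ)) (u : ℚ × ℚ) : Prop := u ∈ M ∧ ∃ v ∈ M, u + v = 0

/-- `a` is an atom (irreducible element) of `M`: a non-invertible element of `M` such
that whenever `a = b + c` with `b, c ∈ M`, either `b` or `c` is invertible in `M`. -/
def IsAtomIn (M : AddSubmonoid (ℚ × ℚ)) (a : ℚ × ℚ) : Prop :=
  a ∈ M ∧ ¬ IsUnitIn M a ∧
    ∀ b ∈ M, ∀ c ∈ M, a = b + c → IsUnitIn M b ∨ IsUnitIn M c

/-- `M` is atomic: every non-invertible element of `M` is a finite sum of atoms of `M`. -/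
def AtomicIn (M : AddSubmonoid (ℚ × ℚ)) : Prop :=
  ∀ x ∈ M, ¬ IsUnitIn M x →
    ∃ (k : ℕ) (f : Fin k → ℚ × ℚ), (∀ i, IsAtomIn M (f i)) ∧ x = ∑ i, f i

lemma nthPrime_prime (m : ℕ) : (nthPrime m).Prime := Nat.prime_nth_prime _

lemma nthPrime_inj {m k : ℕ} (hm : 1 ≤ m) (hk : 1 ≤ k) (h : nthPrime m = nthPrime k) : m = k := by
  have := Nat.nth_injective Nat.infinite_setOfPred_prime h
  omega

lemma nthPrime_one : nthPrime 1 = 2 := Nat.nth_prime_zero_eq_two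

lemma den_one_div_natCast {k : ℕ} (hk : 0 < k) : ((1 : ℚ) / (k : ℚ)).den = k := by
  rw [one_div, Rat.inv_natCast_den, if_neg hk.ne']

lemma fst_nonneg_of_mem_closure {S : Set (ℚ × ℚ)} (hpos : ∀ s ∈ S, 0 < s.1) {x : ℚ × ℚ}
    (hx : x ∈ AddSubmonoid.closure S) : 0 ≤ x.1 ∧ (x.1 = 0 → x = 0) := by
  induction hx using AddSubmonoid.closure_induction with
  | mem s hs => exact ⟨(hpos s hs).le, fun h => absurd h (hpos s hs).ne'⟩
  | zero => simp
  | add x y _ _ ihx ihy =>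
    refine ⟨add_nonneg ihx.1 ihy.1, fun h => ?_⟩
    obtain ⟨h1, h2⟩ := (add_eq_zero_iff_of_nonneg ihx.1 ihy.1).1 h
    rw [ihx.2 h1, ihy.2 h2, add_zero]

lemma exists_eq_add_of_dvd_den {S : Set (ℚ × ℚ)} {p : ℕ} (hp : p.Prime) {g : ℚ × ℚ}
    (hS : ∀ s ∈ S, p ∣ s.1.den → s = g) {x : ℚ × ℚ}
    (hx : x ∈ AddSubmonoid.closure S) :
    p ∣ x.1.den → ∃ y ∈ AddSubmonoid.closure S, x = g + y := by
  induction hx using AddSubmonoid.closure_induction with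
  | mem s hs => exact fun h => ⟨0, zero_mem _, by rw [hS s hs h, add_zero]⟩
  | zero => exact fun h => absurd (Nat.dvd_one.1 h) hp.ne_one
  | add x y hx hy ihx ihy =>
    intro h
    rcases hp.dvd_mul.1 (h.trans (Rat.add_den_dvd x.1 y.1)) with h | h
    · obtain ⟨z, hz, rfl⟩ := ihx h
      exact ⟨z + y, add_mem hz hy, add_assoc _ _ _⟩
    · obtain ⟨z, hz, rfl⟩ := ihy h
      exact ⟨x + z, add_mem hx hz, add_left_comm _ _ _⟩

/-- A generator is an atom if some prime divides the denominator of its first coordinate but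
not that of any other generator. -/
lemma isAtomIn_closure_of_prime {S : Set (ℚ × ℚ)} {p : ℕ} (hp : p.Prime) {g : ℚ × ℚ}
    (hpos : ∀ s ∈ S, 0 < s.1) (hg : g ∈ S) (hgp : p ∣ g.1.den)
    (hS : ∀ s ∈ S, p ∣ s.1.den → s = g) :
    IsAtomIn (AddSubmonoid.closure S) g := by
  have eq_zero_of_add {x y : ℚ × ℚ} (hx : x ∈ AddSubmonoid.closure S)
      (hy : y ∈ AddSubmonoid.closure S) (h : x + y = 0) : x = 0 := by
    have hx' := fst_nonneg_of_mem_closure hpos hx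
    exact hx'.2 ((add_eq_zero_iff_of_nonneg hx'.1
      (fst_nonneg_of_mem_closure hpos hy).1).1 (congrArg Prod.fst h)).1
  have isUnitIn_zero : IsUnitIn (AddSubmonoid.closure S) 0 :=
    ⟨zero_mem _, 0, zero_mem _, add_zero 0⟩
  refine ⟨AddSubmonoid.subset_closure hg, ?_, fun b hb c hc h => ?_⟩
  · rintro ⟨hgM, v, hv, h⟩
    exact (hpos g hg).ne' (congrArg Prod.fst (eq_zero_of_add hgM hv h))
  · have hdvd : p ∣ b.1.den * c.1.den := by
      refine hgp.trans ?_
      rw [h]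
      exact Rat.add_den_dvd b.1 c.1
    rcases hp.dvd_mul.1 hdvd with hd | hd
    · obtain ⟨y, hy, rfl⟩ := exists_eq_add_of_dvd_den hp hS hb hd
      right
      rw [add_assoc, left_eq_add, add_comm] at h
      exact eq_zero_of_add hc hy h ▸ isUnitIn_zero
    · obtain ⟨y, hy, rfl⟩ := exists_eq_add_of_dvd_den hp hS hc hd
      left
      rw [add_left_comm, left_eq_add] at h
      exact eq_zero_of_add hb hy h ▸ isUnitIn_zero

/-- The elements of `genSet` in a single sequence, indexed by the position of the prime. -/
noncomputable def generator (m : ℕ) : ℚ × ℚ :=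
  (1 / ((2 ^ (m / 2) * nthPrime m : ℕ) : ℚ), if Even m then 0 else 1 / (nthPrime m : ℚ))

lemma exists_eq_generator {x : ℚ × ℚ} (hx : x ∈ genSet) : ∃ m, 2 ≤ m ∧ x = generator m := by
  obtain ⟨n, hn, rfl | rfl⟩ := hx
  · exact ⟨2 * n, by omega, by simp [generator]⟩
  · have h : (2 * n + 1) / 2 = n := by omega
    exact ⟨2 * n + 1, by omega, by simp [generator, h]⟩

lemma den_generator_fst (m : ℕ) : (generator m).1.den = 2 ^ (m / 2) * nthPrime m :=
  den_one_div_natCast (Nat.mul_pos (by positivity) (nthPrime_prime m).pos)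

lemma generator_fst_pos (m : ℕ) : 0 < (generator m).1 :=
  one_div_pos.2 (Nat.cast_pos.2 (Nat.mul_pos (by positivity) (nthPrime_prime m).pos))

lemma eq_of_nthPrime_dvd_den {m k : ℕ} (hm : 2 ≤ m) (hk : 1 ≤ k)
    (h : nthPrime m ∣ (generator k).1.den) : k = m := by
  rw [den_generator_fst] at h
  rcases (nthPrime_prime m).dvd_mul.1 h with h | h
  · have h2 := (Nat.prime_dvd_prime_iff_eq (nthPrime_prime m) Nat.prime_two).1
      ((nthPrime_prime m).dvd_of_dvd_pow h)
    have := nthPrime_inj (by omega) le_rfl (h2.trans nthPrime_one.symm)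
    omega
  · exact (nthPrime_inj (by omega) hk
      ((Nat.prime_dvd_prime_iff_eq (nthPrime_prime m) (nthPrime_prime k)).1 h)).symm

lemma isAtomIn_of_mem_genSet {x : ℚ × ℚ} (hx : x ∈ genSet) :
    IsAtomIn (AddSubmonoid.closure genSet) x := by
  obtain ⟨m, hm, rfl⟩ := exists_eq_generator hx
  refine isAtomIn_closure_of_prime (nthPrime_prime m) (fun s hs => ?_) hx
    (den_generator_fst m ▸ dvd_mul_left _ _) (fun s hs h => ?_)
  · obtain ⟨k, -, rfl⟩ := exists_eq_generator hs
    exact generator_fst_pos k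
  · obtain ⟨k, hk, rfl⟩ := exists_eq_generator hs
    rw [eq_of_nthPrime_dvd_den hm (by omega) h]

/-- The submonoid `M` of `ℚ≥0²` generated by
`{(1/(2ⁿ p_{2n}), 0), (1/(2ⁿ p_{2n+1}), 1/p_{2n+1}) : n ≥ 1}` (with `pₖ` the `k`-th
prime) is atomic, and every element of the generating set is an atom of `M`. -/
theorem rank2_example_atomic (M : AddSubmonoid (ℚ × ℚ))
    (hM : M = AddSubmonoid.closure genSet) :
    AtomicIn M ∧ ∀ x ∈ genSet, IsAtomIn M x := by
  subst hM
  refine ⟨fun x hx _ => ?_, fun x hx => isAtomIn_of_mem_genSet hx⟩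
  obtain ⟨l, hl, rfl⟩ := AddSubmonoid.exists_list_of_mem_closure hx
  exact ⟨l.length, fun i => l[i], fun i => isAtomIn_of_mem_genSet (hl _ (l.getElem_mem i.2)),
    (Fin.sum_univ_getElem l).symm⟩
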